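/- arXiv:1712.00314 — 3 statements merged into one kernel-verified Lean document; each statement's English description precedes it below -/
import Mathlib

section
/- Assume moreover that 𝒞 is a generator for 𝒢(𝒞)^{⊥1}. Let 0→M'→C→M→0 be a short exact sequence in 𝒜 with C∈𝒞 which remains exact after applying Hom_𝒜(C',−) for every C'∈𝒞. If M admits a special 𝒢(𝒞)-precover, then M' admits a special 𝒢(𝒞)-precover. -/
open CategoryTheory CategoryTheory.Limits CategoryTheory.Abelian ZeroObject

universe w t v u

variable {A : Type u} [Category.{v} A] [Abelian A]

/-- `f`, `g` form a short exact sequence `0 ⟶ X ⟶ Y ⟶ Z ⟶ 0` in `A`. -/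
def IsSES {X Y Z : A} (f : X ⟶ Y) (g : Y ⟶ Z) : Prop :=
  ∃ hw : f ≫ g = 0, (ShortComplex.mk f g hw).ShortExact

/-- The short exact sequence `0 ⟶ X ⟶ Y ⟶ Z ⟶ 0` remains exact after applying
`Hom_A(C, -)` for every `C` in `𝒞`. -/
def HomLeftExact (𝒞 : A → Prop) {X Y Z : A} (f : X ⟶ Y) (g : Y ⟶ Z) : Prop :=
  ∀ ⦃C : A⦄, 𝒞 C →
    Function.Injective (fun h : C ⟶ X => h ≫ f) ∧
    Function.Exact (fun h : C ⟶ X => h ≫ f) (fun h : C ⟶ Y => h ≫ g) ∧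
    Function.Surjective (fun h : C ⟶ Y => h ≫ g)

/-- The short exact sequence `0 ⟶ X ⟶ Y ⟶ Z ⟶ 0` remains exact after applying
`Hom_A(-, C)` for every `C` in `𝒞`. -/
def HomRightExact (𝒞 : A → Prop) {X Y Z : A} (f : X ⟶ Y) (g : Y ⟶ Z) : Prop :=
  ∀ ⦃C : A⦄, 𝒞 C →
    Function.Injective (fun h : Z ⟶ C => g ≫ h) ∧
    Function.Exact (fun h : Z ⟶ C => g ≫ h) (fun h : Y ⟶ C => f ≫ h) ∧
    Function.Surjective (fun h : Y ⟶ C => f ≫ h)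

/-- `M` belongs to the Gorenstein subcategory `𝒢(𝒞)`: there is an exact sequence
`⋯ ⟶ C_1 ⟶ C_0 ⟶ C^0 ⟶ C^1 ⟶ ⋯` with all terms in `𝒞`, which remains exact after
applying `Hom_A(C,-)` and `Hom_A(-,C)` for every `C ∈ 𝒞`, such that
`M ≅ Im(C_0 ⟶ C^0)`. -/
def IsGorenstein (𝒞 : A → Prop) (M : A) : Prop :=
  ∃ (X : ℤ → A) (d : ∀ n : ℤ, X n ⟶ X (n + 1)) (hw : ∀ n, d n ≫ d (n + 1) = 0),
    (∀ n, 𝒞 (X n)) ∧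
    (∀ n, (ShortComplex.mk (d n) (d (n + 1)) (hw n)).Exact) ∧
    (∀ (n : ℤ) ⦃C : A⦄, 𝒞 C →
      Function.Exact (fun h : C ⟶ X n => h ≫ d n) (fun h : C ⟶ X (n + 1) => h ≫ d (n + 1))) ∧
    (∀ (n : ℤ) ⦃C : A⦄, 𝒞 C →
      Function.Exact (fun h : X (n + 1 + 1) ⟶ C => d (n + 1) ≫ h)
        (fun h : X (n + 1) ⟶ C => d n ≫ h)) ∧
    Nonempty (M ≅ Limits.image (d 0))

/-- `𝒞` is a full additive subcategory closed under isomorphisms, encoded as a predicate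
closed under isomorphisms, containing a zero object and closed under binary biproducts. -/
def IsAdditiveClosed (𝒞 : A → Prop) : Prop :=
  (∀ ⦃X Y : A⦄, (X ≅ Y) → 𝒞 X → 𝒞 Y) ∧ 𝒞 (0 : A) ∧ ∀ ⦃X Y : A⦄, 𝒞 X → 𝒞 Y → 𝒞 (X ⊞ Y)

/-- `𝒫(A)` is a generator for `𝒞`: for every `C ∈ 𝒞` there is a short exact sequence
`0 ⟶ C' ⟶ P ⟶ C ⟶ 0` with `P` projective and `C' ∈ 𝒞`. -/
def ProjIsGeneratorFor (𝒞 : A → Prop) : Prop :=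
  ∀ ⦃C : A⦄, 𝒞 C → ∃ (C' P : A) (f : C' ⟶ P) (g : P ⟶ C),
    Projective P ∧ 𝒞 C' ∧ IsSES f g

section Ext

variable [HasExt.{w} A]

/-- `𝒞` is self-orthogonal: `Ext^i(C, C') = 0` for all `i ≥ 1` and `C, C' ∈ 𝒞`. -/
def SelfOrthogonal (𝒞 : A → Prop) : Prop :=
  ∀ ⦃C C' : A⦄, 𝒞 C → 𝒞 C' → ∀ i : ℕ, 1 ≤ i → Subsingleton (Abelian.Ext C C' i)

/-- `M ∈ 𝒢(𝒞)^{⊥1}`, i.e. `Ext^1(G, M) = 0` for every `G ∈ 𝒢(𝒞)`. -/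
def RightPerp1 (𝒞 : A → Prop) (M : A) : Prop :=
  ∀ ⦃G : A⦄, IsGorenstein 𝒞 G → Subsingleton (Abelian.Ext G M 1)

/-- `f : G ⟶ M` is a special `𝒢(𝒞)`-precover of `M`. -/
def IsSpecialPrecover (𝒞 : A → Prop) {G M : A} (f : G ⟶ M) : Prop :=
  IsGorenstein 𝒞 G ∧ Epi f ∧ RightPerp1 𝒞 (kernel f) ∧
    ∀ ⦃G' : A⦄, IsGorenstein 𝒞 G' → Function.Surjective (fun h : G' ⟶ G => h ≫ f)

/-- `M` belongs to the special precovered category `spc(𝒢(𝒞))`. -/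
def HasSpecialPrecover (𝒞 : A → Prop) (M : A) : Prop :=
  ∃ (G : A) (f : G ⟶ M), IsSpecialPrecover 𝒞 f

/-- `𝒞` is a generator for `𝒢(𝒞)^{⊥1}`. -/
def GeneratorForPerp (𝒞 : A → Prop) : Prop :=
  ∀ ⦃T : A⦄, RightPerp1 𝒞 T → ∃ (T' C : A) (f : T' ⟶ C) (g : C ⟶ T),
    𝒞 C ∧ RightPerp1 𝒞 T' ∧ IsSES f g

end Ext

namespace IsSES

section

variable {X Y Z : A} {f : X ⟶ Y} {g : Y ⟶ Z}

theorem mono (h : IsSES f g) : Mono f := h.2.mono_f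

theorem epi (h : IsSES f g) : Epi g := h.2.epi_g

theorem exists_lift (h : IsSES f g) {T : A} (t : T ⟶ Y) (ht : t ≫ g = 0) :
    ∃ l : T ⟶ X, l ≫ f = t := by
  have := h.mono
  exact ⟨_, h.2.exact.lift_f t ht⟩

theorem exists_desc (h : IsSES f g) {T : A} (t : Y ⟶ T) (ht : f ≫ t = 0) :
    ∃ l : Z ⟶ T, g ≫ l = t := by
  have := h.epi
  exact ⟨_, h.2.exact.g_desc t ht⟩

theorem of_lift (hw : f ≫ g = 0) (hf : Mono f) (hg : Epi g)
    (H : ∀ ⦃T : A⦄ (t : T ⟶ Y), t ≫ g = 0 → ∃ l : T ⟶ X, l ≫ f = t) : IsSES f g := by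
  refine ⟨hw, { exact := ?_, mono_f := hf, epi_g := hg }⟩
  refine ShortComplex.exact_of_f_is_kernel _ (KernelFork.IsLimit.ofι' _ _ fun t ht => ?_)
  exact ⟨(H t ht).choose, (H t ht).choose_spec⟩

theorem of_desc (hw : f ≫ g = 0) (hf : Mono f) (hg : Epi g)
    (H : ∀ ⦃T : A⦄ (t : Y ⟶ T), f ≫ t = 0 → ∃ l : Z ⟶ T, g ≫ l = t) : IsSES f g := by
  refine ⟨hw, { exact := ?_, mono_f := hf, epi_g := hg }⟩
  refine ShortComplex.exact_of_g_is_cokernel _ (CokernelCofork.IsColimit.ofπ' _ _ fun t ht => ?_)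
  exact ⟨(H t ht).choose, (H t ht).choose_spec⟩

theorem kernel_ι (g : Y ⟶ Z) [Epi g] : IsSES (kernel.ι g) g :=
  of_lift (kernel.condition g) inferInstance inferInstance
    fun _ t ht => ⟨kernel.lift g t ht, kernel.lift_ι g t ht⟩

theorem inr_iso_fst {X Y Z : A} (e : X ⊞ Y ≅ Z) :
    IsSES (biprod.inr ≫ e.hom) (e.inv ≫ biprod.fst) := by
  refine of_lift (by simp) inferInstance inferInstance fun T t ht => ⟨t ≫ e.inv ≫ biprod.snd, ?_⟩
  rw [← cancel_mono e.inv]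
  ext <;> simp [ht]

theorem inl_iso_snd {X Y Z : A} (e : X ⊞ Y ≅ Z) :
    IsSES (biprod.inl ≫ e.hom) (e.inv ≫ biprod.snd) := by
  refine of_lift (by simp) inferInstance inferInstance fun T t ht => ⟨t ≫ e.inv ≫ biprod.fst, ?_⟩
  rw [← cancel_mono e.inv]
  ext <;> simp [ht]

theorem id_right (h : IsSES f g) (B : A) :
    IsSES (f ≫ biprod.inl) (biprod.map g (𝟙 B)) := by
  have := h.mono
  have := h.epi
  refine of_lift ?_ inferInstance inferInstance fun T t ht => ?_
  · ext <;> simp [h.1]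
  · obtain ⟨l, hl⟩ := h.exists_lift (t ≫ biprod.fst) (by simpa using ht =≫ biprod.fst)
    refine ⟨l, ?_⟩
    ext
    · simpa using hl
    · simpa using (ht =≫ biprod.snd).symm

theorem id_left (h : IsSES f g) (B : A) :
    IsSES (biprod.map f (𝟙 B)) (biprod.fst ≫ g) := by
  have := h.mono
  have := h.epi
  refine of_lift ?_ inferInstance inferInstance fun T t ht => ?_
  · ext <;> simp [h.1]
  · obtain ⟨l, hl⟩ := h.exists_lift (t ≫ biprod.fst) (by simpa using ht)
    refine ⟨biprod.lift l (t ≫ biprod.snd), ?_⟩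
    ext <;> simp [hl]

/-- If the kernel of `r` lifts along `p`, then the kernel of `p ≫ r` is `K ⊞ B`. -/
theorem comp_of_lift {K E Q B L : A} {i : K ⟶ E} {p : E ⟶ Q} {s : B ⟶ Q} {r : Q ⟶ L}
    (h₁ : IsSES i p) (h₂ : IsSES s r) (l : B ⟶ E) (hl : l ≫ p = s) :
    IsSES (biprod.desc i l) (p ≫ r) := by
  have := h₁.mono
  have := h₁.epi
  have := h₂.mono
  have := h₂.epi
  refine of_lift ?_ ?_ inferInstance fun T t ht => ?_
  · ext
    · simp [reassoc_of% h₁.1]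
    · simp [reassoc_of% hl, h₂.1]
  · refine Preadditive.mono_of_cancel_zero _ fun {T} t ht => ?_
    have ht' : t ≫ biprod.fst ≫ i + t ≫ biprod.snd ≫ l = 0 := by
      rw [biprod.desc_eq, Preadditive.comp_add] at ht
      exact ht
    have h2 : t ≫ biprod.snd = 0 := by
      rw [← cancel_mono s]
      simpa [h₁.1, hl] using ht' =≫ p
    have h1 : t ≫ biprod.fst = 0 := by
      rw [← cancel_mono i]
      simpa [reassoc_of% h2] using ht'
    ext <;> simp [h1, h2]
  · obtain ⟨y, hy⟩ := h₂.exists_lift (t ≫ p) (by simpa using ht)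
    obtain ⟨x, hx⟩ := h₁.exists_lift (t - y ≫ l) (by simp [hl, hy])
    exact ⟨biprod.lift x y, by simp [hx]⟩

/-- If the cokernel of `r` extends along `i`, then the cokernel of `r ≫ i` is `R ⊞ B`. -/
theorem comp_of_desc {Q E R L B : A} {i : Q ⟶ E} {p : E ⟶ R} {r : L ⟶ Q} {s : Q ⟶ B}
    (h₁ : IsSES i p) (h₂ : IsSES r s) (l : E ⟶ B) (hl : i ≫ l = s) :
    IsSES (r ≫ i) (biprod.lift p l) := by
  have := h₁.mono
  have := h₁.epi
  have := h₂.mono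
  have := h₂.epi
  refine of_desc ?_ inferInstance ?_ fun T t ht => ?_
  · ext
    · simp [h₁.1]
    · simp [hl, h₂.1]
  · refine Preadditive.epi_of_cancel_zero _ fun {T} t ht => ?_
    have ht' : p ≫ biprod.inl ≫ t + l ≫ biprod.inr ≫ t = 0 := by
      rw [biprod.lift_eq, Preadditive.add_comp] at ht
      simpa using ht
    have h2 : biprod.inr ≫ t = 0 := by
      rw [← cancel_epi s]
      simpa [reassoc_of% h₁.1, reassoc_of% hl] using i ≫= ht'
    have h1 : biprod.inl ≫ t = 0 := by
      rw [← cancel_epi p]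
      simpa [h2] using ht'
    ext <;> simp [h1, h2]
  · obtain ⟨y, hy⟩ := h₂.exists_desc (i ≫ t) (by simpa using ht)
    obtain ⟨x, hx⟩ := h₁.exists_desc (t - l ≫ y) (by simp [reassoc_of% hl, hy])
    exact ⟨biprod.desc x y, by simp [hx]⟩

/-- Schanuel's lemma, for two epimorphisms which factor through each other. -/
theorem schanuel {L B G K D : A} {ι : L ⟶ B} {q : B ⟶ G} {j : K ⟶ D} {r : D ⟶ G}
    (h₁ : IsSES ι q) (h₂ : IsSES j r) (a : D ⟶ B) (ha : a ≫ q = r) (b : B ⟶ D)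
    (hb : b ≫ r = q) : Nonempty (L ⊞ D ≅ K ⊞ B) := by
  have := h₁.mono
  have := h₂.mono
  obtain ⟨x, hx⟩ := h₂.exists_lift (biprod.desc (-(ι ≫ b)) (𝟙 D - a ≫ b)) (by
    ext <;> simp [ha, hb, h₁.1])
  obtain ⟨y, hy⟩ := h₁.exists_lift (biprod.desc (-(j ≫ a)) (𝟙 B - b ≫ a)) (by
    ext <;> simp [ha, hb, h₂.1])
  have hx' : x ≫ j = biprod.snd - biprod.desc ι a ≫ b := by
    rw [hx]; ext <;> simp
  have hy' : y ≫ ι = biprod.snd - biprod.desc j b ≫ a := by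
    rw [hy]; ext <;> simp
  have e₁ : biprod.lift x (biprod.desc ι a) ≫ biprod.desc j b = biprod.snd := by
    rw [biprod.lift_desc, hx']; simp
  have e₂ : biprod.lift y (biprod.desc j b) ≫ biprod.desc ι a = biprod.snd := by
    rw [biprod.lift_desc, hy']; simp
  refine ⟨⟨biprod.lift x (biprod.desc ι a), biprod.lift y (biprod.desc j b), ?_, ?_⟩⟩
  · apply biprod.hom_ext
    · rw [← cancel_mono ι]
      simp only [Category.assoc, biprod.lift_fst, Category.id_comp, hy', Preadditive.comp_sub,
        biprod.lift_snd, reassoc_of% e₁]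
      ext <;> simp
    · simp [e₁]
  · apply biprod.hom_ext
    · rw [← cancel_mono j]
      simp only [Category.assoc, biprod.lift_fst, Category.id_comp, hx', Preadditive.comp_sub,
        biprod.lift_snd, reassoc_of% e₂]
      ext <;> simp
    · simp [e₂]

end

section

variable [HasExt.{w} A] {X Y Z : A} {f : X ⟶ Y} {g : Y ⟶ Z}

theorem exists_lift_of_ext (h : IsSES f g) {D : A} (hD : Subsingleton (Abelian.Ext D X 1))
    (t : D ⟶ Z) : ∃ l : D ⟶ Y, l ≫ g = t := by
  obtain ⟨x, hx⟩ := Abelian.Ext.covariant_sequence_exact₃ D h.2 (Abelian.Ext.mk₀ t) (zero_add 1)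
    (Subsingleton.elim (α := Abelian.Ext D X 1) _ _)
  obtain ⟨l, rfl⟩ := (Abelian.Ext.mk₀_bijective _ _).2 x
  rw [Abelian.Ext.mk₀_comp_mk₀] at hx
  exact ⟨l, (Abelian.Ext.mk₀_bijective _ _).1 hx⟩

theorem exists_desc_of_ext (h : IsSES f g) {D : A} (hD : Subsingleton (Abelian.Ext Z D 1))
    (t : X ⟶ D) : ∃ l : Y ⟶ D, f ≫ l = t := by
  obtain ⟨x, hx⟩ := Abelian.Ext.contravariant_sequence_exact₁ h.2 D (Abelian.Ext.mk₀ t)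
    (add_zero 1) (Subsingleton.elim (α := Abelian.Ext Z D 1) _ _)
  obtain ⟨l, rfl⟩ := (Abelian.Ext.mk₀_bijective _ _).2 x
  rw [Abelian.Ext.mk₀_comp_mk₀] at hx
  exact ⟨l, (Abelian.Ext.mk₀_bijective _ _).1 hx⟩

theorem ext_of_exists_lift (h : IsSES f g) {D : A} (hD : Subsingleton (Abelian.Ext D Y 1))
    (H : ∀ t : D ⟶ Z, ∃ l : D ⟶ Y, l ≫ g = t) : Subsingleton (Abelian.Ext D X 1) := by
  refine subsingleton_of_forall_eq 0 fun x => ?_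
  obtain ⟨y, rfl⟩ := Abelian.Ext.covariant_sequence_exact₁ D h.2 x (Subsingleton.elim _ _)
    (zero_add 1)
  obtain ⟨t, rfl⟩ := (Abelian.Ext.mk₀_bijective _ _).2 y
  obtain ⟨l, rfl⟩ := H t
  rw [← Abelian.Ext.mk₀_comp_mk₀, Abelian.Ext.comp_assoc_of_second_deg_zero]
  simp [h.2.comp_extClass]

theorem ext_of_exists_desc (h : IsSES f g) {D : A} (hD : Subsingleton (Abelian.Ext Y D 1))
    (H : ∀ t : X ⟶ D, ∃ l : Y ⟶ D, f ≫ l = t) : Subsingleton (Abelian.Ext Z D 1) := by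
  refine subsingleton_of_forall_eq 0 fun x => ?_
  obtain ⟨y, rfl⟩ := Abelian.Ext.contravariant_sequence_exact₃ h.2 D x (Subsingleton.elim _ _)
    (add_zero 1)
  obtain ⟨t, rfl⟩ := (Abelian.Ext.mk₀_bijective _ _).2 y
  obtain ⟨l, rfl⟩ := H t
  rw [← Abelian.Ext.mk₀_comp_mk₀]
  exact h.2.extClass_comp_assoc _

end

end IsSES

theorem Abelian.Ext.subsingleton_of_retract_left [HasExt.{w} A] {X Y Z : A} {n : ℕ} (s : X ⟶ Y)
    (r : Y ⟶ X) (h : s ≫ r = 𝟙 X) (hY : Subsingleton (Abelian.Ext Y Z n)) :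
    Subsingleton (Abelian.Ext X Z n) := by
  refine subsingleton_of_forall_eq 0 fun x => ?_
  have hx : (Abelian.Ext.mk₀ s).comp ((Abelian.Ext.mk₀ r).comp x (zero_add n))
      (zero_add n) = x := by
    rw [Abelian.Ext.mk₀_comp_mk₀_assoc, h, Abelian.Ext.mk₀_id_comp]
  rw [← hx, Subsingleton.elim ((Abelian.Ext.mk₀ r).comp x (zero_add n)) 0, Abelian.Ext.comp_zero]

theorem Abelian.Ext.subsingleton_of_retract_right [HasExt.{w} A] {X Y Z : A} {n : ℕ} (s : X ⟶ Y)
    (r : Y ⟶ X) (h : s ≫ r = 𝟙 X) (hY : Subsingleton (Abelian.Ext Z Y n)) :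
    Subsingleton (Abelian.Ext Z X n) := by
  refine subsingleton_of_forall_eq 0 fun x => ?_
  have hx : (x.comp (Abelian.Ext.mk₀ s) (add_zero n)).comp (Abelian.Ext.mk₀ r)
      (add_zero n) = x := by
    simp [h]
  rw [← hx, Subsingleton.elim (x.comp (Abelian.Ext.mk₀ s) (add_zero n)) 0, Abelian.Ext.zero_comp]

theorem exists_int_seq {α : Type*} {r : α → α → Prop} (hr : ∀ a, ∃ b, r a b)
    (hl : ∀ a, ∃ b, r b a) (a : α) : ∃ f : ℤ → α, f 1 = a ∧ ∀ n, r (f n) (f (n + 1)) := by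
  choose R hR using hr
  choose L hL using hl
  let F : ℤ → α := fun n => match n with
    | Int.ofNat k => R^[k] a
    | Int.negSucc k => L^[k + 1] a
  have hF : ∀ n, r (F n) (F (n + 1)) := by
    rintro (k | k)
    · change r (R^[k] a) (R^[k + 1] a)
      rw [Function.iterate_succ_apply']
      exact hR _
    · rcases k with _ | k
      · exact hL a
      · change r (L^[k + 1 + 1] a) (L^[k + 1] a)
        rw [Function.iterate_succ_apply' L (k + 1)]
        exact hL _
  refine ⟨fun n => F (n - 1), rfl, fun n => ?_⟩
  have := hF (n - 1)
  rwa [show n - 1 + 1 = n + 1 - 1 by ring] at this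

/-- A class `𝒲` such that each of its members `M` fits into short exact sequences
`0 ⟶ K ⟶ C ⟶ M ⟶ 0` and `0 ⟶ M ⟶ C' ⟶ Q ⟶ 0` with `K` and `Q` in `𝒲` and `C` and `C'` in `𝒞`,
and such that `Ext^1` vanishes between `𝒲` and `𝒞` in both directions. -/
structure IsSyzygyClass [HasExt.{w} A] (𝒞 𝒲 : A → Prop) : Prop where
  exists_left : ∀ ⦃M : A⦄, 𝒲 M → ∃ (K C : A) (i : K ⟶ C) (p : C ⟶ M), 𝒲 K ∧ 𝒞 C ∧ IsSES i p
  exists_right : ∀ ⦃M : A⦄, 𝒲 M → ∃ (Q C : A) (i : M ⟶ C) (p : C ⟶ Q), 𝒲 Q ∧ 𝒞 C ∧ IsSES i p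
  ext_left : ∀ ⦃M C : A⦄, 𝒲 M → 𝒞 C → Subsingleton (Abelian.Ext M C 1)
  ext_right : ∀ ⦃M C : A⦄, 𝒲 M → 𝒞 C → Subsingleton (Abelian.Ext C M 1)

section

variable [HasExt.{w} A] {𝒞 : A → Prop}

theorem IsSyzygyClass.isGorenstein {𝒲 : A → Prop} (h : IsSyzygyClass 𝒞 𝒲) {M : A} (hM : 𝒲 M) :
    IsGorenstein 𝒞 M := by
  obtain ⟨W, hW, hr⟩ := exists_int_seq (α := {M : A // 𝒲 M})
    (r := fun K Q => ∃ (C : A) (i : K.1 ⟶ C) (p : C ⟶ Q.1), 𝒞 C ∧ IsSES i p)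
    (fun K => by
      obtain ⟨Q, C, i, p, hQ, hC, hip⟩ := h.exists_right K.2
      exact ⟨⟨Q, hQ⟩, C, i, p, hC, hip⟩)
    (fun Q => by
      obtain ⟨K, C, i, p, hK, hC, hip⟩ := h.exists_left Q.2
      exact ⟨⟨K, hK⟩, C, i, p, hC, hip⟩) ⟨M, hM⟩
  choose X i p hX hip using hr
  have hi : ∀ n, Mono (i n) := fun n => (hip n).mono
  have hp : ∀ n, Epi (p n) := fun n => (hip n).epi
  have := strongEpi_of_epi (p 0)
  refine ⟨X, fun n => p n ≫ i (n + 1), fun n => ?_, hX, fun n => ?_, fun n C hC t => ?_,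
    fun n C hC t => ?_, ⟨eqToIso ?_ ≪≫ image.isoStrongEpiMono (p 0) (i (0 + 1)) rfl⟩⟩
  · simp [reassoc_of% (hip (n + 1)).1]
  · rw [ShortComplex.exact_iff_exact_up_to_refinements]
    intro T x hx
    dsimp at x hx
    obtain ⟨y, hy⟩ := (hip (n + 1)).exists_lift x (by
      rw [← cancel_mono (i (n + 1 + 1))]
      simpa using hx)
    obtain ⟨T', π, hπ, z, hz⟩ := surjective_up_to_refinements_of_epi (p n) y
    exact ⟨T', π, hπ, z, by simp [← hy, reassoc_of% hz]⟩
  · constructor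
    · intro ht
      obtain ⟨y, hy⟩ := (hip (n + 1)).exists_lift t (by
        rw [← cancel_mono (i (n + 1 + 1))]
        simpa using ht)
      obtain ⟨z, hz⟩ := (hip n).exists_lift_of_ext (h.ext_right (W n).2 hC) y
      exact ⟨z, by simp [← hy, reassoc_of% hz]⟩
    · rintro ⟨y, rfl⟩
      simp [reassoc_of% (hip (n + 1)).1]
  · constructor
    · intro ht
      obtain ⟨y, hy⟩ := (hip (n + 1)).exists_desc t (by
        rw [← cancel_epi (p n)]
        simpa using ht)
      obtain ⟨z, hz⟩ := (hip (n + 1 + 1)).exists_desc_of_ext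
        (h.ext_left (W (n + 1 + 1 + 1)).2 hC) y
      exact ⟨z, by simp [← hy, hz]⟩
    · rintro ⟨y, rfl⟩
      simp [reassoc_of% (hip (n + 1)).1]
  · rw [zero_add, hW]

theorem isSyzygyClass_isGorenstein (hso : SelfOrthogonal 𝒞) :
    IsSyzygyClass 𝒞 (IsGorenstein 𝒞) := by
  suffices H : ∀ ⦃M : A⦄, IsGorenstein 𝒞 M → ∃ 𝒲 : A → Prop, IsSyzygyClass 𝒞 𝒲 ∧ 𝒲 M by
    refine ⟨fun M hM => ?_, fun M hM => ?_, fun M C hM hC => ?_, fun M C hM hC => ?_⟩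
    all_goals obtain ⟨𝒲, h, hM⟩ := H hM
    · obtain ⟨K, C, i, p, hK, hC, hip⟩ := h.exists_left hM
      exact ⟨K, C, i, p, h.isGorenstein hK, hC, hip⟩
    · obtain ⟨Q, C, i, p, hQ, hC, hip⟩ := h.exists_right hM
      exact ⟨Q, C, i, p, h.isGorenstein hQ, hC, hip⟩
    · exact h.ext_left hM hC
    · exact h.ext_right hM hC
  rintro M ⟨X, d, hw, hX, hd, hl, hr, hM⟩
  refine ⟨fun N => ∃ n, Nonempty (N ≅ image (d n)), ?_, 0, hM⟩
  have hcond : ∀ n, Limits.image.ι (d n) ≫ d (n + 1) = 0 := fun n => by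
    rw [← cancel_epi (factorThruImage (d n))]
    simpa using hw n
  have hses : ∀ n, IsSES (Limits.image.ι (d n)) (factorThruImage (d (n + 1))) := fun n => by
    refine IsSES.of_lift ?_ inferInstance inferInstance fun T t ht => ?_
    · rw [← cancel_mono (Limits.image.ι (d (n + 1)))]
      simpa using hcond n
    · have hk : IsSES (Limits.image.ι (d n)) (cokernel.π (Limits.image.ι (d n))) :=
        ⟨cokernel.condition _, { exact := ShortComplex.cokernelSequence_exact _,
                                 mono_f := inferInstance, epi_g := inferInstance }⟩
      refine hk.exists_lift t ?_
      have ht' : t ≫ d (n + 1) = 0 := by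
        rw [← Limits.image.fac (d (n + 1)), reassoc_of% ht, zero_comp]
      obtain ⟨T', π, hπ, y, hy⟩ :=
        (ShortComplex.exact_iff_exact_up_to_refinements _).1 (hd n) t ht'
      dsimp at y hy
      have hdπ : d n ≫ cokernel.π (Limits.image.ι (d n)) = 0 :=
        (Limits.image.fac_assoc (d n) _).symm.trans (by simp)
      rw [← cancel_epi π, reassoc_of% hy, hdπ]
      simp
  have hsucc : ∀ n : ℤ, ∃ m, n = m + 1 := fun n => ⟨n - 1, by ring⟩
  refine ⟨?_, ?_, ?_, ?_⟩
  · rintro N ⟨n, ⟨e⟩⟩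
    obtain ⟨m, rfl⟩ := hsucc n
    have := (hses m).epi
    refine ⟨_, _, Limits.image.ι (d m), factorThruImage (d (m + 1)) ≫ e.inv, ⟨m, ⟨Iso.refl _⟩⟩,
      hX _, IsSES.of_lift (by simp [reassoc_of% (hses m).1]) inferInstance inferInstance
      fun T t ht => ?_⟩
    exact (hses m).exists_lift t (by simpa using ht =≫ e.hom)
  · rintro N ⟨n, ⟨e⟩⟩
    have := (hses n).epi
    refine ⟨_, _, e.hom ≫ Limits.image.ι (d n), factorThruImage (d (n + 1)), ⟨n + 1, ⟨Iso.refl _⟩⟩,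
      hX _, IsSES.of_lift (by simp [(hses n).1]) inferInstance inferInstance
      fun T t ht => ?_⟩
    obtain ⟨l, hl⟩ := (hses n).exists_lift t ht
    exact ⟨l ≫ e.inv, by simpa using hl⟩
  · rintro N C ⟨n, ⟨e⟩⟩ hC
    obtain ⟨m, rfl⟩ := hsucc n
    obtain ⟨k, rfl⟩ := hsucc m
    refine Abelian.Ext.subsingleton_of_retract_left e.hom e.inv e.hom_inv_id ?_
    refine (hses (k + 1)).ext_of_exists_desc (hso (hX _) hC 1 le_rfl) fun t => ?_
    obtain ⟨y, hy⟩ := (hr k hC (factorThruImage (d (k + 1)) ≫ t)).1 (by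
      have hdk : d k ≫ factorThruImage (d (k + 1)) = 0 := by
        rw [← cancel_mono (Limits.image.ι (d (k + 1)))]
        simpa using hw k
      exact (reassoc_of% hdk) t |>.trans zero_comp)
    refine ⟨y, ?_⟩
    rw [← cancel_epi (factorThruImage (d (k + 1)))]
    simpa using hy
  · rintro N C ⟨n, ⟨e⟩⟩ hC
    refine Abelian.Ext.subsingleton_of_retract_right e.hom e.inv e.hom_inv_id ?_
    refine (hses n).ext_of_exists_lift (hso hC (hX _) 1 le_rfl) fun t => ?_
    obtain ⟨y, hy⟩ := (hl (n + 1) hC (t ≫ Limits.image.ι (d (n + 1)))).1 (by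
      change (t ≫ Limits.image.ι _) ≫ d (n + 1 + 1) = 0
      simp [hcond])
    refine ⟨y, ?_⟩
    rw [← cancel_mono (Limits.image.ι (d (n + 1)))]
    simpa using hy

theorem isGorenstein_of_mem (hadd : IsAdditiveClosed 𝒞) (hso : SelfOrthogonal 𝒞) {C : A}
    (hC : 𝒞 C) : IsGorenstein 𝒞 C := by
  refine IsSyzygyClass.isGorenstein (𝒲 := 𝒞) ⟨fun M hM => ?_, fun M hM => ?_,
    fun M C hM hC => hso hM hC 1 le_rfl, fun M C hM hC => hso hC hM 1 le_rfl⟩ hC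
  · exact ⟨0, M, 0, 𝟙 M, hadd.2.1, hM, IsSES.of_lift (by simp) inferInstance inferInstance
      fun T t ht => ⟨0, by simpa using ht.symm⟩⟩
  · exact ⟨0, M, 𝟙 M, 0, hadd.2.1, hM, IsSES.of_lift (by simp) inferInstance inferInstance
      fun T t ht => ⟨t, by simp⟩⟩

/-- An object stably equivalent to a Gorenstein object, modulo `𝒞`, is Gorenstein. -/
theorem isGorenstein_of_biprod_iso (hadd : IsAdditiveClosed 𝒞) (hso : SelfOrthogonal 𝒞)
    {L B G D : A} (hB : 𝒞 B) (hG : IsGorenstein 𝒞 G) (hD : 𝒞 D) (e : L ⊞ B ≅ G ⊞ D) :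
    IsGorenstein 𝒞 L := by
  have hS := isSyzygyClass_isGorenstein hso
  refine IsSyzygyClass.isGorenstein (𝒲 := fun L => ∃ B G D : A,
    𝒞 B ∧ IsGorenstein 𝒞 G ∧ 𝒞 D ∧ Nonempty (L ⊞ B ≅ G ⊞ D)) ⟨?_, ?_, ?_, ?_⟩
    ⟨B, G, D, hB, hG, hD, ⟨e⟩⟩
  · rintro L ⟨B, G, D, hB, hG, hD, ⟨e⟩⟩
    obtain ⟨K, C, i, p, hK, hC, hip⟩ := hS.exists_left hG
    obtain ⟨l, hl⟩ := (hip.id_right D).exists_lift_of_ext (hS.ext_right hK hB)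
      (biprod.inr ≫ e.hom)
    exact ⟨_, _, _, _, ⟨0, K, B, hadd.2.1, hK, hB, ⟨(isoBiprodZero (isZero_zero A)).symm⟩⟩,
      hadd.2.2 hC hD, (hip.id_right D).comp_of_lift (IsSES.inr_iso_fst e) l hl⟩
  · rintro L ⟨B, G, D, hB, hG, hD, ⟨e⟩⟩
    obtain ⟨Q, C, i, p, hQ, hC, hip⟩ := hS.exists_right hG
    obtain ⟨l, hl⟩ := (hip.id_left D).exists_desc_of_ext (hS.ext_left hQ hB)
      (e.inv ≫ biprod.snd)
    exact ⟨_, _, _, _, ⟨0, Q, B, hadd.2.1, hQ, hB, ⟨(isoBiprodZero (isZero_zero A)).symm⟩⟩,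
      hadd.2.2 hC hD, (hip.id_left D).comp_of_desc (IsSES.inl_iso_snd e) l hl⟩
  · rintro L C ⟨B, G, D, hB, hG, hD, ⟨e⟩⟩ hC
    have := hS.ext_left hG hC
    have := hso hD hC 1 le_rfl
    exact Abelian.Ext.subsingleton_of_retract_left (biprod.inl ≫ e.hom) (e.inv ≫ biprod.fst)
      (by simp) Abelian.Ext.biprodAddEquiv.injective.subsingleton
  · rintro L C ⟨B, G, D, hB, hG, hD, ⟨e⟩⟩ hC
    have := hS.ext_right hG hC
    have := hso hC hD 1 le_rfl
    exact Abelian.Ext.subsingleton_of_retract_right (biprod.inl ≫ e.hom) (e.inv ≫ biprod.fst)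
      (by simp) Abelian.Ext.addEquivBiprod.injective.subsingleton

theorem isGorenstein_of_isSES (hadd : IsAdditiveClosed 𝒞) (hso : SelfOrthogonal 𝒞)
    {L B G : A} {i : L ⟶ B} {q : B ⟶ G} (h : IsSES i q) (hB : 𝒞 B) (hG : IsGorenstein 𝒞 G)
    (hq : ∀ ⦃D : A⦄, 𝒞 D → ∀ t : D ⟶ G, ∃ l : D ⟶ B, l ≫ q = t) : IsGorenstein 𝒞 L := by
  have hS := isSyzygyClass_isGorenstein hso
  obtain ⟨K, D, j, r, hK, hD, hjr⟩ := hS.exists_left hG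
  obtain ⟨a, ha⟩ := hq hD r
  obtain ⟨b, hb⟩ := hjr.exists_lift_of_ext (hS.ext_right hK hB) q
  obtain ⟨e⟩ := h.schanuel hjr a ha b hb
  exact isGorenstein_of_biprod_iso hadd hso hD hK hB e

theorem hasSpecialPrecover_of_isSES {K L M : A} {i : K ⟶ L} {q : L ⟶ M} (h : IsSES i q)
    (hL : IsGorenstein 𝒞 L) (hK : RightPerp1 𝒞 K) : HasSpecialPrecover 𝒞 M := by
  have := h.mono
  refine ⟨L, q, hL, h.epi, fun G hG => ?_, fun G hG t => h.exists_lift_of_ext (hK hG) t⟩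
  obtain ⟨s, hs⟩ := h.exists_lift (kernel.ι q) (kernel.condition q)
  refine Abelian.Ext.subsingleton_of_retract_right s (kernel.lift q i h.1) ?_ (hK hG)
  rw [← cancel_mono (kernel.ι q)]
  simpa using hs

end

/-- assume `𝒞` is a generator for `𝒢(𝒞)^{⊥1}`. Given a `Hom(𝒞,-)`-exact
short exact sequence `0 ⟶ M' ⟶ C ⟶ M ⟶ 0` with `C ∈ 𝒞`, if `M` admits a special
`𝒢(𝒞)`-precover then so does `M'`. -/
theorem stmt_10 [HasExt.{w} A] (𝒞 : A → Prop) (hadd : IsAdditiveClosed 𝒞)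
    (hso : SelfOrthogonal 𝒞) (hgen : ProjIsGeneratorFor 𝒞)
    (hCgen : GeneratorForPerp 𝒞)
    {M' C M : A} (f : M' ⟶ C) (g : C ⟶ M) (hC : 𝒞 C) (hses : IsSES f g)
    (hlex : HomLeftExact 𝒞 f g)
    (h : HasSpecialPrecover 𝒞 M) :
    HasSpecialPrecover 𝒞 M' := by
  obtain ⟨G, p, hG, hp, hK, hpG⟩ := h
  have := hses.mono
  have := hses.epi
  obtain ⟨K', D, i, k, hD, hK', hik⟩ := hCgen hK
  have := hik.mono
  have := hik.epi
  have hker := IsSES.kernel_ι p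
  obtain ⟨c, hc⟩ := hpG (isGorenstein_of_mem hadd hso hC) g
  dsimp at hc
  let q : D ⊞ C ⟶ G := biprod.desc (k ≫ kernel.ι p) c
  have hqp : q ≫ p = biprod.snd ≫ g := by
    ext <;> simp [q, hc]
  have : Epi q := by
    refine Preadditive.epi_of_cancel_zero _ fun {T} t ht => ?_
    obtain ⟨t', rfl⟩ := hker.exists_desc t (by
      rw [← cancel_epi k]
      simpa [q] using biprod.inl ≫= ht)
    have h0 : t' = 0 := by
      rw [← cancel_epi g, ← hc]
      simpa [q] using biprod.inr ≫= ht
    simp [h0]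
  have hq := IsSES.kernel_ι q
  have hL : IsGorenstein 𝒞 (kernel q) := by
    refine isGorenstein_of_isSES hadd hso hq (hadd.2.2 hD hC) hG fun B hB t => ?_
    obtain ⟨a, ha⟩ := (hlex hB).2.2 (t ≫ p)
    dsimp at ha
    obtain ⟨b, hb⟩ := hker.exists_lift (t - a ≫ c) (by simp [hc, ha])
    obtain ⟨l, hl⟩ := hik.exists_lift_of_ext (hK' (isGorenstein_of_mem hadd hso hB)) b
    exact ⟨biprod.lift l a, by simp [q, reassoc_of% hl, hb]⟩
  obtain ⟨r, hr⟩ := hses.exists_lift (kernel.ι q ≫ biprod.snd) (by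
    rw [Category.assoc, ← hqp, reassoc_of% hq.1, zero_comp])
  obtain ⟨j, hj⟩ := hq.exists_lift (i ≫ biprod.inl) (by simp [q, reassoc_of% hik.1])
  have hjr : IsSES j r := by
    refine IsSES.of_lift ?_ ?_ ?_ fun T t ht => ?_
    · rw [← cancel_mono f, Category.assoc, hr, reassoc_of% hj]
      simp
    · have : Mono (j ≫ kernel.ι q) := hj ▸ inferInstance
      exact mono_of_mono j (kernel.ι q)
    · obtain ⟨y, hy⟩ := hker.exists_lift (f ≫ c) (by simp [hc, hses.1])
      obtain ⟨T, π, hπ, z, hz⟩ := surjective_up_to_refinements_of_epi k (-y)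
      obtain ⟨x, hx⟩ := hq.exists_lift (biprod.lift z (π ≫ f)) (by
        simp [q, ← reassoc_of% hz, hy])
      have hxr : x ≫ r = π := by
        rw [← cancel_mono f, Category.assoc, hr, reassoc_of% hx, biprod.lift_snd]
      have : Epi (x ≫ r) := hxr ▸ hπ
      exact epi_of_epi x r
    · have h2 : t ≫ kernel.ι q ≫ biprod.snd = 0 := by
        rw [← hr, reassoc_of% ht, zero_comp]
      have h1 : (t ≫ kernel.ι q ≫ biprod.fst) ≫ k = 0 := by
        rw [← cancel_mono (kernel.ι p)]
        have hqe : q = biprod.fst ≫ k ≫ kernel.ι p + biprod.snd ≫ c := biprod.desc_eq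
        have h0 : t ≫ kernel.ι q ≫ (biprod.fst ≫ k ≫ kernel.ι p + biprod.snd ≫ c) = 0 := by
          rw [← hqe]
          simp
        simpa [reassoc_of% h2] using h0
      obtain ⟨l, hl⟩ := hik.exists_lift _ h1
      refine ⟨l, ?_⟩
      rw [← cancel_mono (kernel.ι q)]
      ext <;> simp [hj, hl, h2]
  exact hasSpecialPrecover_of_isSES hjr hL hK'
end

section
/- The special precovered category spc(𝒢(𝒞)) is closed under 𝒞-stable direct summands: if M admits a special 𝒢(𝒞)-precover and M ≅ L ⊕ C with C∈𝒞, then L admits a special 𝒢(𝒞)-precover. -/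
open CategoryTheory CategoryTheory.Limits CategoryTheory.Abelian ZeroObject

universe w t v u

variable {A : Type u} [Category.{v} A] [Abelian A]

/-- Objects of a self-orthogonal `𝒞` lie in the right `Ext¹`-orthogonal of `𝒢(𝒞)`. -/
theorem SelfOrthogonal.rightPerp1 [HasExt.{w} A] {𝒞 : A → Prop} (hso : SelfOrthogonal 𝒞)
    {C : A} (hC : 𝒞 C) : RightPerp1 𝒞 C := by
  rintro G ⟨X, d, hw, hX, hex, -, hright, ⟨i⟩⟩
  obtain ⟨n, hn⟩ : ∃ n : ℤ, n + 1 + 1 = 0 := ⟨-2, by norm_num⟩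
  have himage : ∀ m : ℤ, m = 0 → Nonempty (G ≅ image (d m)) := by
    rintro _ rfl
    exact ⟨i⟩
  obtain ⟨i⟩ := himage _ hn
  let p : X (n + 1 + 1) ⟶ G := factorThruImage (d (n + 1 + 1)) ≫ i.inv
  have hp : p ≫ i.hom ≫ image.ι (d (n + 1 + 1)) = d (n + 1 + 1) := by simp [p]
  have : Epi p := epi_comp _ _
  let S : ShortComplex A := ShortComplex.mk (kernel.ι p) p (kernel.condition p)
  have hS : S.ShortExact :=
    { exact := ShortComplex.exact_of_f_is_kernel _ (kernelIsKernel p)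
      mono_f := inferInstanceAs (Mono (kernel.ι p))
      epi_g := inferInstanceAs (Epi p) }
  have hdp : d (n + 1) ≫ p = 0 := by
    rw [← cancel_mono (i.hom ≫ image.ι (d (n + 1 + 1))), Category.assoc, hp, hw, zero_comp]
  let a : X (n + 1) ⟶ kernel p := kernel.lift p (d (n + 1)) hdp
  have ha : a ≫ kernel.ι p = d (n + 1) := kernel.lift_ι _ _ _
  have : Epi a := by
    rw [epi_iff_surjective_up_to_refinements]
    intro T y
    obtain ⟨T', π, hπ, x, hx⟩ := (hex (n + 1)).exact_up_to_refinements (y ≫ kernel.ι p)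
      (by simp [← hp])
    refine ⟨T', π, hπ, x, ?_⟩
    rw [← cancel_mono (kernel.ι p)]
    simpa [ha] using hx
  have hext (h : kernel p ⟶ C) : ∃ k : X (n + 1 + 1) ⟶ C, kernel.ι p ≫ k = h := by
    obtain ⟨k, hk⟩ := (hright n hC (a ≫ h)).1 (by
      have hda : d n ≫ a = 0 := by
        rw [← cancel_mono (kernel.ι p), Category.assoc, ha, hw, zero_comp]
      simp only [reassoc_of% hda, zero_comp])
    refine ⟨k, ?_⟩
    rw [← cancel_epi a, ← Category.assoc, ha]
    exact hk
  refine ⟨fun x y => ?_⟩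
  suffices h0 : ∀ x : Abelian.Ext G C 1, x = 0 by rw [h0 x, h0 y]
  intro x
  have := hso (hX (n + 1 + 1)) hC 1 le_rfl
  obtain ⟨x₁, rfl⟩ := Ext.contravariant_sequence_exact₃ hS C x (Subsingleton.elim _ _)
    (add_zero 1)
  obtain ⟨h, rfl⟩ := (Ext.mk₀_bijective _ _).2 x₁
  obtain ⟨k, rfl⟩ := hext h
  rw [← Ext.mk₀_comp_mk₀]
  exact hS.extClass_comp_assoc _

/-- The right `Ext¹`-orthogonal of `𝒢(𝒞)` is closed under extensions. -/
theorem RightPerp1.of_shortExact [HasExt.{w} A] {𝒞 : A → Prop} {S : ShortComplex A}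
    (hS : S.ShortExact) (h₁ : RightPerp1 𝒞 S.X₁) (h₃ : RightPerp1 𝒞 S.X₃) :
    RightPerp1 𝒞 S.X₂ := by
  intro G hG
  have := h₁ hG
  have := h₃ hG
  refine ⟨fun x y => ?_⟩
  suffices h0 : ∀ x : Abelian.Ext G S.X₂ 1, x = 0 by rw [h0 x, h0 y]
  intro x
  obtain ⟨x₁, rfl⟩ := Ext.covariant_sequence_exact₂ G hS x (Subsingleton.elim _ _)
  rw [Subsingleton.elim x₁ 0, Ext.zero_comp]

/-- An epimorphism from an object of `𝒢(𝒞)` with kernel in the right `Ext¹`-orthogonal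
of `𝒢(𝒞)` is a special precover. -/
theorem IsSpecialPrecover.of_epi [HasExt.{w} A] {𝒞 : A → Prop} {G M : A} (f : G ⟶ M) [Epi f]
    (hG : IsGorenstein 𝒞 G) (hf : RightPerp1 𝒞 (kernel f)) : IsSpecialPrecover 𝒞 f := by
  refine ⟨hG, inferInstance, hf, fun G' hG' g => ?_⟩
  let S : ShortComplex A := ShortComplex.mk (kernel.ι f) f (kernel.condition f)
  have hS : S.ShortExact :=
    { exact := ShortComplex.exact_of_f_is_kernel _ (kernelIsKernel f)
      mono_f := inferInstanceAs (Mono (kernel.ι f))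
      epi_g := inferInstanceAs (Epi f) }
  have : Subsingleton (Abelian.Ext G' S.X₁ 1) := hf hG'
  obtain ⟨x, hx⟩ := Ext.covariant_sequence_exact₃ G' hS (Ext.mk₀ g) (zero_add 1)
    (Subsingleton.elim _ _)
  obtain ⟨h, rfl⟩ := (Ext.mk₀_bijective _ _).2 x
  rw [Ext.mk₀_comp_mk₀] at hx
  exact ⟨h, (Ext.mk₀_bijective _ _).1 hx⟩

/-- For an epimorphism `f : G ⟶ L ⊞ C`, the kernel of its first component is an extension
of `C` by the kernel of `f`. -/
theorem exists_shortExact_kernel_comp_fst {G L C : A} (f : G ⟶ L ⊞ C) [Epi f] :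
    ∃ (i : kernel f ⟶ kernel (f ≫ biprod.fst)) (q : kernel (f ≫ biprod.fst) ⟶ C)
      (hw : i ≫ q = 0), (ShortComplex.mk i q hw).ShortExact := by
  let i : kernel f ⟶ kernel (f ≫ biprod.fst) := kernel.lift _ (kernel.ι f) (by simp)
  have hi : i ≫ kernel.ι (f ≫ biprod.fst) = kernel.ι f := kernel.lift_ι _ _ _
  refine ⟨i, kernel.ι _ ≫ f ≫ biprod.snd, by simp [reassoc_of% hi], ?_⟩
  have : Mono i := mono_of_mono_fac hi
  have : Epi (kernel.ι (f ≫ biprod.fst) ≫ f ≫ biprod.snd) := by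
    rw [epi_iff_surjective_up_to_refinements]
    intro T c
    obtain ⟨T', π, hπ, y, hy⟩ := surjective_up_to_refinements_of_epi f (c ≫ biprod.inr)
    refine ⟨T', π, hπ, kernel.lift _ y ?_, ?_⟩
    · rw [← reassoc_of% hy]; simp
    · rw [kernel.lift_ι_assoc, ← reassoc_of% hy]; simp
  refine { exact := ?_ }
  rw [ShortComplex.exact_iff_exact_up_to_refinements]
  intro T x hx
  have hxf : (x ≫ kernel.ι (f ≫ biprod.fst)) ≫ f = 0 := by
    ext
    · simp
    · simpa using hx
  refine ⟨T, 𝟙 T, inferInstance, kernel.lift f _ hxf, ?_⟩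
  rw [← cancel_mono (kernel.ι (f ≫ biprod.fst))]
  simp [hi]

/-- `spc(𝒢(𝒞))` is closed under `𝒞`-stable direct summands. -/
theorem stmt_12 [HasExt.{w} A] (𝒞 : A → Prop) (hadd : IsAdditiveClosed 𝒞)
    (hso : SelfOrthogonal 𝒞) (hgen : ProjIsGeneratorFor 𝒞)
    {M L C : A} (hM : HasSpecialPrecover 𝒞 M) (e : M ≅ L ⊞ C) (hC : 𝒞 C) :
    HasSpecialPrecover 𝒞 L := by
  obtain ⟨G, f, hG, hf, hK, -⟩ := hM
  obtain ⟨i, q, hw, hS⟩ := exists_shortExact_kernel_comp_fst (f ≫ e.hom)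
  have hK' : RightPerp1 𝒞 (kernel (f ≫ e.hom)) := fun G' hG' => by
    have := hK hG'
    let j : kernel f ≅ kernel (f ≫ e.hom) := (kernelCompMono f e.hom).symm
    refine ⟨fun x y => ?_⟩
    have h0 : ∀ x : Abelian.Ext G' (kernel (f ≫ e.hom)) 1, x = 0 := fun x => by
      rw [← Ext.comp_mk₀_id x, ← j.inv_hom_id, ← Ext.mk₀_comp_mk₀,
        ← Ext.comp_assoc_of_second_deg_zero,
        Subsingleton.elim (x.comp (Ext.mk₀ j.inv) (add_zero 1)) 0, Ext.zero_comp]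
    rw [h0 x, h0 y]
  exact ⟨G, (f ≫ e.hom) ≫ biprod.fst, .of_epi _ hG
    (RightPerp1.of_shortExact hS hK' (hso.rightPerp1 hC))⟩
end

section
/- Assume moreover that 𝒞 is a generator for 𝒢(𝒞)^{⊥1}. Let 𝒳 be any subcategory of 𝒜 (full, additive, closed under isomorphisms) such that 𝒢(𝒞)^{⊥1}∪𝒢(𝒞)⊆𝒳, 𝒳 is closed under extensions, and 𝒳 is closed under 𝒞-stable direct summands (X⊕C∈𝒳 with C∈𝒞 implies X∈𝒳). Then spc(𝒢(𝒞))⊆𝒳; consequently spc(𝒢(𝒞)) is the minimal subcategory of 𝒜 containing 𝒢(𝒞)^{⊥1}∪𝒢(𝒞) with these closure properties. -/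
open CategoryTheory CategoryTheory.Limits CategoryTheory.Abelian ZeroObject

universe w t v u

variable {A : Type u} [Category.{v} A] [Abelian A]

/-- An object of `𝒞` belongs to `𝒢(𝒞)`. -/
lemma IsGorenstein.of_mem {𝒞 : A → Prop} (hadd : IsAdditiveClosed 𝒞) {C : A} (hC : 𝒞 C) :
    IsGorenstein 𝒞 C := by
  let d : C ⊞ C ⟶ C ⊞ C := biprod.fst ≫ biprod.inr
  let s : C ⊞ C ⟶ C ⊞ C := biprod.snd ≫ biprod.inl
  have hdd : d ≫ d = 0 := by simp [d]
  have hs : d ≫ s + s ≫ d = 𝟙 (C ⊞ C) := by simp [d, s, biprod.total]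
  have hleft {T : A} (x : T ⟶ C ⊞ C) (hx : x ≫ d = 0) : (x ≫ s) ≫ d = x := by
    simpa [reassoc_of% hx] using x ≫= hs
  have hright {T : A} (x : C ⊞ C ⟶ T) (hx : d ≫ x = 0) : d ≫ s ≫ x = x := by
    simpa [hx] using hs =≫ x
  refine ⟨fun _ => C ⊞ C, fun _ => d, fun _ => hdd, fun _ => hadd.2.2 hC hC, fun _ => ?_,
    fun _ D _ x => ⟨fun hx => ⟨x ≫ s, hleft x hx⟩, ?_⟩,
    fun _ D _ x => ⟨fun hx => ⟨s ≫ x, hright x hx⟩, ?_⟩, ⟨?_⟩⟩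
  · rw [ShortComplex.exact_iff_exact_up_to_refinements]
    intro T x hx
    exact ⟨T, 𝟙 T, inferInstance, x ≫ s, by simpa using (hleft x hx).symm⟩
  · rintro ⟨y, rfl⟩
    simp [hdd]
  · rintro ⟨y, rfl⟩
    simp [reassoc_of% hdd]
  · exact IsImage.isoExt
      (F := { I := C, m := biprod.inr, e := biprod.fst })
      { lift := fun F' => biprod.inl ≫ F'.e } (Image.isImage _)

/-- The image of every differential of a complex as in the definition of `𝒢(𝒞)` belongs
to `𝒢(𝒞)`. -/
lemma IsGorenstein.of_iso_image {𝒞 : A → Prop} {X : ℤ → A} {d : ∀ n : ℤ, X n ⟶ X (n + 1)}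
    (hw : ∀ n, d n ≫ d (n + 1) = 0) (hX : ∀ n, 𝒞 (X n))
    (hex : ∀ n, (ShortComplex.mk (d n) (d (n + 1)) (hw n)).Exact)
    (hl : ∀ (n : ℤ) ⦃C : A⦄, 𝒞 C → Function.Exact (fun h : C ⟶ X n => h ≫ d n)
      (fun h : C ⟶ X (n + 1) => h ≫ d (n + 1)))
    (hr : ∀ (n : ℤ) ⦃C : A⦄, 𝒞 C →
      Function.Exact (fun h : X (n + 1 + 1) ⟶ C => d (n + 1) ≫ h)
        (fun h : X (n + 1) ⟶ C => d n ≫ h))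
    (n : ℤ) {M : A} (e : M ≅ Limits.image (d n)) : IsGorenstein 𝒞 M := by
  let D (a b : ℤ) (h : a + 1 = b) : X a ⟶ X b := d a ≫ eqToHom (by rw [h])
  have hD (a : ℤ) : D a (a + 1) rfl = d a := by simp [D]
  have hDw (a b c : ℤ) (h : a + 1 = b) (h' : b + 1 = c) : D a b h ≫ D b c h' = 0 := by
    subst h h'
    simpa [hD] using hw a
  have hn (k : ℤ) : k + n + 1 = k + 1 + n := add_right_comm k n 1
  refine ⟨fun k => X (k + n), fun k => D (k + n) (k + 1 + n) (hn k),
    fun k => hDw _ _ _ (hn k) (hn (k + 1)), fun k => hX _, fun k => ?_, fun k C hC => ?_, fun k C hC => ?_, ?_⟩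
  · have key (a b c : ℤ) (h : a + 1 = b) (h' : b + 1 = c) :
        (ShortComplex.mk (D a b h) (D b c h') (hDw a b c h h')).Exact := by
      subst h h'
      simpa only [hD] using hex a
    exact key _ _ _ (hn k) (hn (k + 1))
  · have key (a b c : ℤ) (h : a + 1 = b) (h' : b + 1 = c) :
        Function.Exact (fun x : C ⟶ X a => x ≫ D a b h) (fun x : C ⟶ X b => x ≫ D b c h') := by
      subst h h'
      simpa only [hD] using hl a hC
    exact key _ _ _ (hn k) (hn (k + 1))
  · have key (a b c : ℤ) (h : a + 1 = b) (h' : b + 1 = c) :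
        Function.Exact (fun x : X c ⟶ C => D b c h' ≫ x) (fun x : X b ⟶ C => D a b h ≫ x) := by
      subst h h'
      simpa only [hD] using hr a hC
    exact key _ _ _ (hn k) (hn (k + 1))
  · have key (a b : ℤ) (h : a + 1 = b) (ha : a = n) : Nonempty (M ≅ Limits.image (D a b h)) := by
      subst h ha
      exact ⟨e ≪≫ image.eqToIso (hD a).symm⟩
    exact key _ _ (hn 0) (zero_add n)

/-- Every object of `𝒢(𝒞)` is a subobject of an object of `𝒞`. -/
lemma IsGorenstein.exists_mono {𝒞 : A → Prop} {G : A} (hG : IsGorenstein 𝒞 G) :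
    ∃ (C : A) (i : G ⟶ C), 𝒞 C ∧ Mono i := by
  obtain ⟨X, d, -, hX, -, -, -, ⟨e⟩⟩ := hG
  exact ⟨X (0 + 1), e.hom ≫ Limits.image.ι (d 0), hX _, inferInstance⟩

/-- The short exact sequence `0 ⟶ Im f ⟶ Y ⟶ Im g ⟶ 0` attached to an exact sequence
`X ⟶ Y ⟶ Z`. -/
lemma shortExact_image {X Y Z : A} {f : X ⟶ Y} {g : Y ⟶ Z} {w : f ≫ g = 0}
    (h : (ShortComplex.mk f g w).Exact) :
    ∃ w' : Limits.image.ι f ≫ factorThruImage g = 0,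
      (ShortComplex.mk (Limits.image.ι f) (factorThruImage g) w').ShortExact := by
  have w₁ : Limits.image.ι f ≫ g = 0 := by
    rw [← cancel_epi (factorThruImage f)]
    simpa using w
  have w₂ : Limits.image.ι f ≫ factorThruImage g = 0 := by
    rw [← cancel_mono (Limits.image.ι g)]
    simpa using w₁
  let φ : ShortComplex.mk f g w ⟶ ShortComplex.mk (Limits.image.ι f) g w₁ :=
    { τ₁ := factorThruImage f, τ₂ := 𝟙 _, τ₃ := 𝟙 _ }
  let ψ : ShortComplex.mk (Limits.image.ι f) (factorThruImage g) w₂ ⟶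
      ShortComplex.mk (Limits.image.ι f) g w₁ :=
    { τ₁ := 𝟙 _, τ₂ := 𝟙 _, τ₃ := Limits.image.ι g }
  have : Epi φ.τ₁ := inferInstanceAs (Epi (factorThruImage f))
  have : IsIso φ.τ₂ := inferInstanceAs (IsIso (𝟙 Y))
  have : Mono φ.τ₃ := inferInstanceAs (Mono (𝟙 Z))
  have : Epi ψ.τ₁ := inferInstanceAs (Epi (𝟙 _))
  have : IsIso ψ.τ₂ := inferInstanceAs (IsIso (𝟙 Y))
  have : Mono ψ.τ₃ := inferInstanceAs (Mono (Limits.image.ι g))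
  refine ⟨w₂, { exact := ?_, mono_f := by dsimp; infer_instance, epi_g := by dsimp; infer_instance }⟩
  rw [ShortComplex.exact_iff_of_epi_of_isIso_of_mono ψ,
    ← ShortComplex.exact_iff_of_epi_of_isIso_of_mono φ]
  exact h

/-- Every `G ∈ 𝒢(𝒞)` is the cokernel of a monomorphism `K ⟶ C` with `K ∈ 𝒢(𝒞)` and `C ∈ 𝒞`,
along which morphisms into objects of `𝒞` extend. -/
lemma IsGorenstein.exists_syzygy {𝒞 : A → Prop} {G : A} (hG : IsGorenstein 𝒞 G) :
    ∃ (K C : A) (f : K ⟶ C) (g : C ⟶ G), IsGorenstein 𝒞 K ∧ 𝒞 C ∧ IsSES f g ∧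
      ∀ ⦃C' : A⦄, 𝒞 C' → Function.Surjective (fun h : C ⟶ C' => f ≫ h) := by
  obtain ⟨X, d, hw, hX, hex, hl, hr, ⟨e⟩⟩ := hG
  obtain ⟨w, hS⟩ := shortExact_image (hex (-2 + 1))
  let e' : G ≅ Limits.image (d (-2 + 1 + 1)) := e
  refine ⟨Limits.image (d (-2 + 1)), X (-2 + 1 + 1), Limits.image.ι _, factorThruImage _ ≫ e'.inv,
    IsGorenstein.of_iso_image hw hX hex hl hr (-2 + 1) (Iso.refl _), hX _, ⟨?_, ?_⟩, ?_⟩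
  · rw [reassoc_of% w, zero_comp]
  · exact ShortComplex.shortExact_of_iso
      (S₁ := ShortComplex.mk _ _ w) (ShortComplex.isoMk (Iso.refl _) (Iso.refl _) e'.symm) hS
  · intro C' hC' h
    obtain ⟨y, hy⟩ := (hr (-2) hC' (factorThruImage (d (-2 + 1)) ≫ h)).1 (by
      have : d (-2) ≫ factorThruImage (d (-2 + 1)) = 0 := by
        rw [← cancel_mono (Limits.image.ι _)]
        simpa using hw (-2)
      dsimp only
      rw [reassoc_of% this, zero_comp])
    refine ⟨y, ?_⟩
    rw [← cancel_epi (factorThruImage (d (-2 + 1)))]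
    simpa using hy

/-- The pushout of an epimorphism `f` along `i` is the cokernel of `kernel f ⟶ C`. -/
lemma isSES_pushout_inr {G M C : A} (f : G ⟶ M) (i : G ⟶ C) [Epi f] [Mono i] :
    IsSES (kernel.ι f ≫ i) (pushout.inr f i) := by
  have w : (kernel.ι f ≫ i) ≫ pushout.inr f i = 0 := by
    rw [Category.assoc, ← pushout.condition, kernel.condition_assoc, zero_comp]
  refine ⟨w, { exact := ?_, mono_f := by dsimp; infer_instance, epi_g := by dsimp; infer_instance }⟩
  refine ShortComplex.exact_of_g_is_cokernel _ (CokernelCofork.IsColimit.ofπ' _ _ fun {W} k hk => ?_)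
  dsimp at k hk
  have hk' : kernel.ι f ≫ i ≫ k = 0 := by simpa using hk
  exact ⟨pushout.desc (Abelian.epiDesc f (i ≫ k) hk') k (by simp), pushout.inr_desc _ _ _⟩

section

variable [HasExt.{w} A] {𝒞 : A → Prop}

/-- Dimension shifting: `Ext^{n+1}(Z, T) = 0` if `Ext^n(X, T) = 0` and `Ext^{n+1}(Y, T) = 0`
for a short exact sequence `0 ⟶ X ⟶ Y ⟶ Z ⟶ 0`. -/
lemma IsSES.subsingleton_ext_succ {X Y Z T : A} {f : X ⟶ Y} {g : Y ⟶ Z} (h : IsSES f g) (n : ℕ)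
    (hX : Subsingleton (Abelian.Ext X T n)) (hY : Subsingleton (Abelian.Ext Y T (n + 1))) :
    Subsingleton (Abelian.Ext Z T (n + 1)) := by
  obtain ⟨w, hS⟩ := h
  refine subsingleton_of_forall_eq 0 fun x => ?_
  obtain ⟨y, hy⟩ := Abelian.Ext.contravariant_sequence_exact₃ hS T x (Subsingleton.elim _ _)
    (add_comm 1 n)
  rw [← hy, hX.elim y 0, Abelian.Ext.comp_zero]

/-- Objects of `𝒞` lie in `𝒢(𝒞)^{⊥1}`. -/
lemma RightPerp1.of_mem (hso : SelfOrthogonal 𝒞) {C : A} (hC : 𝒞 C) : RightPerp1 𝒞 C := by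
  intro G hG
  obtain ⟨K, C₀, f, g, -, hC₀, ⟨w, hS⟩, hsurj⟩ := hG.exists_syzygy
  have := hso hC₀ hC 1 le_rfl
  refine subsingleton_of_forall_eq 0 fun x => ?_
  obtain ⟨y, rfl⟩ := Abelian.Ext.contravariant_sequence_exact₃ hS C x (Subsingleton.elim _ _)
    (add_comm 1 0)
  obtain ⟨y, rfl⟩ := Abelian.Ext.addEquiv₀.symm.surjective y
  obtain ⟨z, rfl⟩ := hsurj hC y
  simp only [Abelian.Ext.addEquiv₀_symm_apply, ← Abelian.Ext.mk₀_comp_mk₀]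
  exact hS.extClass_comp_assoc _

/-- `Ext^2(G, T) = 0` for `G ∈ 𝒢(𝒞)` and `T ∈ 𝒢(𝒞)^{⊥1}`. -/
lemma RightPerp1.subsingleton_ext_two (hadd : IsAdditiveClosed 𝒞) (hgen : ProjIsGeneratorFor 𝒞)
    {T G : A} (hT : RightPerp1 𝒞 T) (hG : IsGorenstein 𝒞 G) :
    Subsingleton (Abelian.Ext G T 2) := by
  obtain ⟨K, C, f, g, hK, hC, hS, -⟩ := hG.exists_syzygy
  obtain ⟨C', P, f', g', hP, hC', hS'⟩ := hgen hC
  exact hS.subsingleton_ext_succ 1 (hT hK) (hS'.subsingleton_ext_succ 1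
    (hT (IsGorenstein.of_mem hadd hC')) (Abelian.Ext.subsingleton_of_projective _ _ _))

/-- `𝒢(𝒞)^{⊥1}` is closed under cokernels of monomorphisms. -/
lemma RightPerp1.of_isSES (hadd : IsAdditiveClosed 𝒞) (hgen : ProjIsGeneratorFor 𝒞)
    {X Y Z : A} {f : X ⟶ Y} {g : Y ⟶ Z} (h : IsSES f g)
    (hX : RightPerp1 𝒞 X) (hY : RightPerp1 𝒞 Y) : RightPerp1 𝒞 Z := by
  intro G hG
  obtain ⟨w, hS⟩ := h
  have := hX.subsingleton_ext_two hadd hgen hG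
  refine subsingleton_of_forall_eq 0 fun x => ?_
  obtain ⟨y, hy⟩ := Abelian.Ext.covariant_sequence_exact₃ G hS x (one_add_one_eq_two)
    (Subsingleton.elim _ _)
  rw [← hy, (hY hG).elim y 0, Abelian.Ext.zero_comp]

end


/-- if `𝒞` is a generator for `𝒢(𝒞)^{⊥1}`, then `spc(𝒢(𝒞))` is contained
in every subcategory `𝒳` of `A` containing `𝒢(𝒞)^{⊥1} ∪ 𝒢(𝒞)` which is closed under
extensions and `𝒞`-stable direct summands; hence `spc(𝒢(𝒞))` is minimal with respect to
these properties. -/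
theorem stmt_13 [HasExt.{w} A] (𝒞 : A → Prop) (hadd : IsAdditiveClosed 𝒞)
    (hso : SelfOrthogonal 𝒞) (hgen : ProjIsGeneratorFor 𝒞)
    (hCgen : GeneratorForPerp 𝒞)
    (𝒳 : A → Prop) (h𝒳add : IsAdditiveClosed 𝒳)
    (h𝒳perp : ∀ ⦃M : A⦄, RightPerp1 𝒞 M → 𝒳 M)
    (h𝒳gor : ∀ ⦃M : A⦄, IsGorenstein 𝒞 M → 𝒳 M)
    (h𝒳ext : ∀ ⦃X Y Z : A⦄ (f : X ⟶ Y) (g : Y ⟶ Z), IsSES f g → 𝒳 X → 𝒳 Z → 𝒳 Y)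
    (h𝒳summand : ∀ ⦃X C : A⦄, 𝒞 C → 𝒳 (X ⊞ C) → 𝒳 X) :
    ∀ ⦃M : A⦄, HasSpecialPrecover 𝒞 M → 𝒳 M := by
  rintro M ⟨G, f, hG, hf, hker, -⟩
  obtain ⟨C, i, hC, hi⟩ := hG.exists_mono
  have hN : RightPerp1 𝒞 (pushout f i) :=
    RightPerp1.of_isSES hadd hgen (isSES_pushout_inr f i) hker (RightPerp1.of_mem hso hC)
  have hP : IsPushout f i (pushout.inl f i) (pushout.inr f i) := IsPushout.of_hasPushout f i
  have hmono : Mono hP.shortComplex.f := by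
    have : Mono (hP.shortComplex.f ≫ (-biprod.snd)) := by
      simpa [CommSq.shortComplex] using hi
    exact mono_of_mono _ (-biprod.snd)
  refine h𝒳summand hC (h𝒳ext hP.shortComplex.f hP.shortComplex.g ⟨hP.shortComplex.zero, ?_⟩
    (h𝒳gor hG) (h𝒳perp hN))
  exact { exact := hP.exact_shortComplex, mono_f := hmono, epi_g := hP.epi_shortComplex_g }
end
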